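/- arXiv:1910.10955 — 2 statements merged into one kernel-verified Lean document; each statement's English description precedes it below -/
import Mathlib

section
/- Let d ≥ 1 and s > 1/2. For every h with 0 < h ≤ 1 there exists a constant C > 0 such that for every smooth f : ℝ^d → ℂ, all multi-indices α, β ∈ ℕ^d, and all x ∈ ℝ^d: |x^α ∂^β f(x)| ≤ C (2^{1+s} h)^{|α+β|} (α! β!)^s ‖f‖_h, where ‖f‖_h = sup over γ, κ ∈ ℕ^d of ‖x^γ ∂^κ f‖_{L²(ℝ^d)} / (h^{|γ+κ|} (γ! κ!)^s). -/
open scoped Nat ENNReal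
open MeasureTheory

/-- Partial derivative in the `j`-th coordinate direction. -/
noncomputable def pd {n : ℕ} (j : Fin n) (f : EuclideanSpace ℝ (Fin n) → ℂ) :
    EuclideanSpace ℝ (Fin n) → ℂ :=
  fun z => fderiv ℝ f z (EuclideanSpace.single j 1)

/-- Iterated partial derivative `∂^α` for a multi-index `α ∈ ℕ^n`. -/
noncomputable def pdMulti {n : ℕ} (α : Fin n → ℕ) (f : EuclideanSpace ℝ (Fin n) → ℂ) :
    EuclideanSpace ℝ (Fin n) → ℂ :=
  (List.finRange n).foldr (fun j g => (pd j)^[α j] g) f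

/-- The seminorm `‖f‖_h = sup_{γ,κ} ‖x^γ ∂^κ f‖_{L²} / (h^{|γ+κ|} (γ!κ!)^s)`, with value in
`ℝ≥0∞` (so it is `∞` when the supremum is not finite). -/
noncomputable def gsL2Seminorm {d : ℕ} (s h : ℝ) (f : EuclideanSpace ℝ (Fin d) → ℂ) : ℝ≥0∞ :=
  ⨆ (γ : Fin d → ℕ) (κ : Fin d → ℕ),
    eLpNorm (fun x => (∏ j, (x j : ℂ) ^ (γ j)) * pdMulti κ f x) 2 volume /
      ENNReal.ofReal (h ^ (∑ j, γ j + ∑ j, κ j) *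
        ((∏ j, ((γ j)! : ℝ)) * ∏ j, ((κ j)! : ℝ)) ^ s)


theorem pd_smooth {n : ℕ} (j : Fin n) {f : EuclideanSpace ℝ (Fin n) → ℂ}
    (hf : ContDiff ℝ (⊤ : ℕ∞) f) : ContDiff ℝ (⊤ : ℕ∞) (pd j f) := by
  unfold pd
  exact (hf.fderiv_right (m := (⊤ : ℕ∞)) (by simp)).clm_apply contDiff_const

theorem pd_comm {n : ℕ} (i j : Fin n) {f : EuclideanSpace ℝ (Fin n) → ℂ}
    (hf : ContDiff ℝ (⊤ : ℕ∞) f) : pd i (pd j f) = pd j (pd i f) := by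
  have hd : Differentiable ℝ (fderiv ℝ f) :=
    (hf.fderiv_right (m := (⊤ : ℕ∞)) (by simp)).differentiable (by simp)
  have key : ∀ (i j : Fin n) z, pd i (pd j f) z =
      fderiv ℝ (fderiv ℝ f) z (EuclideanSpace.single i 1) (EuclideanSpace.single j 1) := by
    intro i j z
    unfold pd
    rw [fderiv_clm_apply (hd z) (differentiableAt_const _)]
    simp
  ext z
  rw [key, key]
  have := (hf.contDiffAt (x := z)).isSymmSndFDerivAt (by simp [minSmoothness_of_isRCLikeNormedField]; exact WithTop.coe_le_coe.2 (le_top : (2 : ℕ∞) ≤ ⊤))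
  exact this _ _

theorem pd_iter_smooth {n : ℕ} (j : Fin n) (k : ℕ) {f : EuclideanSpace ℝ (Fin n) → ℂ}
    (hf : ContDiff ℝ (⊤ : ℕ∞) f) : ContDiff ℝ (⊤ : ℕ∞) ((pd j)^[k] f) := by
  induction k with
  | zero => exact hf
  | succ k ih => rw [Function.iterate_succ_apply']; exact pd_smooth j ih

theorem pd_iter_comm {n : ℕ} (i j : Fin n) (k : ℕ) {f : EuclideanSpace ℝ (Fin n) → ℂ}
    (hf : ContDiff ℝ (⊤ : ℕ∞) f) : pd i ((pd j)^[k] f) = (pd j)^[k] (pd i f) := by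
  induction k with
  | zero => rfl
  | succ k ih =>
    rw [Function.iterate_succ_apply', Function.iterate_succ_apply', ← ih,
      pd_comm i j (pd_iter_smooth j k hf)]

theorem foldr_smooth {n : ℕ} (l : List (Fin n)) (α : Fin n → ℕ)
    {f : EuclideanSpace ℝ (Fin n) → ℂ} (hf : ContDiff ℝ (⊤ : ℕ∞) f) :
    ContDiff ℝ (⊤ : ℕ∞) (l.foldr (fun j g => (pd j)^[α j] g) f) := by
  induction l with
  | nil => exact hf
  | cons a l ih => exact pd_iter_smooth a _ ih

theorem foldr_congr' {n : ℕ} (l : List (Fin n)) (α α' : Fin n → ℕ)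
    (f : EuclideanSpace ℝ (Fin n) → ℂ) (h : ∀ j ∈ l, α j = α' j) :
    l.foldr (fun j g => (pd j)^[α j] g) f = l.foldr (fun j g => (pd j)^[α' j] g) f := by
  induction l with
  | nil => rfl
  | cons a l ih =>
    simp only [List.foldr_cons]
    rw [ih (fun j hj => h j (by simp [hj])), h a (by simp)]

theorem pd_foldr {n : ℕ} (i : Fin n) (l : List (Fin n)) (hl : l.Nodup) (hi : i ∈ l)
    (α : Fin n → ℕ) {f : EuclideanSpace ℝ (Fin n) → ℂ} (hf : ContDiff ℝ (⊤ : ℕ∞) f) :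
    pd i (l.foldr (fun j g => (pd j)^[α j] g) f) =
      l.foldr (fun j g => (pd j)^[(Function.update α i (α i + 1)) j] g) f := by
  induction l with
  | nil => simp at hi
  | cons a l ih =>
    simp only [List.foldr_cons]
    rw [List.nodup_cons] at hl
    by_cases hai : a = i
    · subst hai
      rw [Function.update_self, Function.iterate_succ_apply',
        foldr_congr' l (Function.update α a (α a + 1)) α f]
      intro j hj
      rw [Function.update_of_ne]
      rintro rfl
      exact hl.1 hj
    · rw [pd_iter_comm _ _ _ (foldr_smooth l α hf), Function.update_of_ne hai,
        ih hl.2 (by simpa [Ne.symm hai] using hi)]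

theorem pdMulti_smooth {n : ℕ} (α : Fin n → ℕ)
    {f : EuclideanSpace ℝ (Fin n) → ℂ} (hf : ContDiff ℝ (⊤ : ℕ∞) f) :
    ContDiff ℝ (⊤ : ℕ∞) (pdMulti α f) := foldr_smooth _ α hf

theorem pd_pdMulti {n : ℕ} (i : Fin n) (α : Fin n → ℕ)
    {f : EuclideanSpace ℝ (Fin n) → ℂ} (hf : ContDiff ℝ (⊤ : ℕ∞) f) :
    pd i (pdMulti α f) = pdMulti (Function.update α i (α i + 1)) f :=
  pd_foldr i _ (List.nodup_finRange n) (List.mem_finRange i) α hf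

theorem oneD {u u' : ℝ → ℂ} (hu : ∀ t, HasDerivAt u (u' t) t) (hc : Continuous u') (a : ℝ) :
    ‖u a‖ₑ ≤ ∫⁻ t in Set.Icc a (a + 1), (‖u t‖ₑ + ‖u' t‖ₑ) := by
  have hcu : Continuous u := continuous_iff_continuousAt.2 fun t => (hu t).continuousAt
  set M := ∫⁻ t in Set.Icc a (a + 1), ‖u' t‖ₑ
  have hv : volume (Set.Icc a (a + 1)) = 1 := by simp
  calc ‖u a‖ₑ = ∫⁻ t in Set.Icc a (a + 1), ‖u a‖ₑ := by simp
    _ ≤ ∫⁻ t in Set.Icc a (a + 1), (‖u t‖ₑ + M) := by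
      refine setLIntegral_mono' measurableSet_Icc fun t ht => ?_
      have h1 : ∫ r in a..t, u' r = u t - u a :=
        intervalIntegral.integral_eq_sub_of_hasDerivAt (fun r _ => hu r)
          (hc.intervalIntegrable _ _)
      have h2 : u a = u t - ∫ r in a..t, u' r := by rw [h1]; ring
      rw [h2]
      refine (enorm_sub_le).trans ?_
      gcongr
      rw [intervalIntegral.integral_of_le ht.1]
      refine (enorm_integral_le_lintegral_enorm _).trans ?_
      exact lintegral_mono_set fun r hr => ⟨hr.1.le, hr.2.trans ht.2⟩
    _ = _ := by
      rw [lintegral_add_left (by fun_prop), lintegral_add_left (by fun_prop)]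
      simp [M]

theorem scalar_step (s h : ℝ) (hs : 0 ≤ s) (h0 : 0 < h) (h1 : h ≤ 1) (a b : ℕ) :
    h ^ (a + b) * ((a ! : ℝ) * (b ! : ℝ)) ^ s
      + a * (h ^ (a - 1 + b) * (((a - 1)! : ℝ) * (b ! : ℝ)) ^ s)
      + h ^ (a + (b + 1)) * ((a ! : ℝ) * ((b + 1)! : ℝ)) ^ s
    ≤ (2 + 1 / h) * ((2 : ℝ) ^ (1 + s)) ^ (a + b) * (h ^ (a + b) * ((a ! : ℝ) * (b ! : ℝ)) ^ s) := by
  set w := h ^ (a + b) * ((a ! : ℝ) * (b ! : ℝ)) ^ s with hw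
  have hw0 : 0 ≤ w := by positivity
  set Q := ((2 : ℝ) ^ (1 + s)) ^ (a + b) with hQ
  have h2s : (1 : ℝ) ≤ 2 ^ s := Real.one_le_rpow (by norm_num) hs
  have hQe : Q = 2 ^ (a + b) * ((2 : ℝ) ^ s) ^ (a + b) := by
    rw [hQ, Real.rpow_add (by norm_num), Real.rpow_one, mul_pow]
  have p1 : ∀ k : ℕ, (1 : ℝ) ≤ 2 ^ k := fun k => one_le_pow₀ (by norm_num)
  have p2 : ∀ k : ℕ, (1 : ℝ) ≤ ((2 : ℝ) ^ s) ^ k := fun k => one_le_pow₀ h2s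
  have hQ1 : 1 ≤ Q := by rw [hQe]; exact one_le_mul_of_one_le_of_one_le (p1 _) (p2 _)
  have hQa : (2 : ℝ) ^ a ≤ Q := by
    rw [hQe, pow_add]
    calc (2 : ℝ) ^ a = 2 ^ a * 1 * 1 := by ring
      _ ≤ _ := by gcongr; exact p1 _; exact p2 _
  have hQb : ((2 : ℝ) ^ s) ^ b ≤ Q := by
    rw [hQe, pow_add _ a b, pow_add _ a b]
    calc ((2 : ℝ) ^ s) ^ b = (1 * 1) * (1 * ((2 : ℝ) ^ s) ^ b) := by ring
      _ ≤ _ := by gcongr; exact p1 _; exact p1 _; exact p2 _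
  have t2 : a * (h ^ (a - 1 + b) * (((a - 1)! : ℝ) * (b ! : ℝ)) ^ s) ≤ 1 / h * Q * w := by
    rcases a with _ | a
    · simp; positivity
    · have e1 : h ^ (a + b) = 1 / h * h ^ (a + 1 + b) := by
        field_simp; ring
      have e2 : ((a ! : ℝ) * (b ! : ℝ)) ^ s ≤ (((a + 1)! : ℝ) * (b ! : ℝ)) ^ s := by
        gcongr; omega
      have e3 : ((a + 1 : ℕ) : ℝ) ≤ Q :=
        le_trans (by exact_mod_cast (Nat.lt_two_pow_self).le) hQa
      simp only [Nat.add_sub_cancel]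
      calc _ ≤ Q * ((1 / h * h ^ (a + 1 + b)) * (((a + 1)! : ℝ) * (b ! : ℝ)) ^ s) := by
            rw [e1]; gcongr
        _ = _ := by rw [hw]; ring
  have t3 : h ^ (a + (b + 1)) * ((a ! : ℝ) * ((b + 1)! : ℝ)) ^ s ≤ Q * w := by
    have e1 : ((a ! : ℝ) * ((b + 1)! : ℝ)) ^ s =
        ((b + 1 : ℕ) : ℝ) ^ s * ((a ! : ℝ) * (b ! : ℝ)) ^ s := by
      rw [← Real.mul_rpow (by positivity) (by positivity), Nat.factorial_succ]
      push_cast; ring_nf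
    have e2 : ((b + 1 : ℕ) : ℝ) ^ s ≤ Q := by
      refine le_trans ?_ hQb
      rw [← Real.rpow_natCast, ← Real.rpow_mul (by norm_num), mul_comm s, Real.rpow_mul (by norm_num),
        Real.rpow_natCast]
      gcongr
      exact_mod_cast Nat.lt_two_pow_self
    have e3 : h ^ (a + (b + 1)) ≤ h ^ (a + b) := pow_le_pow_of_le_one h0.le h1 (by omega)
    rw [e1]
    calc _ ≤ h ^ (a + b) * (Q * ((a ! : ℝ) * (b ! : ℝ)) ^ s) := by gcongr
      _ = _ := by rw [hw]; ring
  have t1 : w ≤ Q * w := le_mul_of_one_le_left hw0 hQ1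
  calc _ ≤ Q * w + 1 / h * Q * w + Q * w := by gcongr
    _ = _ := by ring

/-- The weighted derivative `y^α ∂^β f (y)` on the plain product space. -/
noncomputable def GG {d : ℕ} (f : EuclideanSpace ℝ (Fin d) → ℂ) (α β : Fin d → ℕ)
    (y : Fin d → ℝ) : ℂ :=
  (∏ j, (y j : ℂ) ^ (α j)) * pdMulti β f (WithLp.toLp 2 y)

theorem GG_cont {d : ℕ} {f : EuclideanSpace ℝ (Fin d) → ℂ} (hf : ContDiff ℝ (⊤ : ℕ∞) f)
    (α β : Fin d → ℕ) : Continuous (GG f α β) := by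
  have h := (pdMulti_smooth β hf).continuous
  unfold GG
  fun_prop

theorem GG_deriv {d : ℕ} {f : EuclideanSpace ℝ (Fin d) → ℂ} (hf : ContDiff ℝ (⊤ : ℕ∞) f)
    (α β : Fin d → ℕ) (i : Fin d) (y : Fin d → ℝ) (t : ℝ) :
    HasDerivAt (fun t => GG f α β (Function.update y i t))
      (α i * GG f (Function.update α i (α i - 1)) β (Function.update y i t)
        + GG f α (Function.update β i (β i + 1)) (Function.update y i t)) t := by
  have hprod : ∀ (α : Fin d → ℕ) (t : ℝ), (∏ j, ((Function.update y i t j : ℝ) : ℂ) ^ (α j)) =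
      (t : ℂ) ^ (α i) * ∏ j ∈ Finset.univ.erase i, (y j : ℂ) ^ (α j) := by
    intro α t
    rw [← Finset.mul_prod_erase _ _ (Finset.mem_univ i), Function.update_self]
    congr 1
    refine Finset.prod_congr rfl fun j hj => ?_
    rw [Function.update_of_ne (Finset.ne_of_mem_erase hj)]
  have hR : ∏ j ∈ Finset.univ.erase i, (y j : ℂ) ^ (Function.update α i (α i - 1) j) =
      ∏ j ∈ Finset.univ.erase i, (y j : ℂ) ^ (α j) := by
    refine Finset.prod_congr rfl fun j hj => ?_
    rw [Function.update_of_ne (Finset.ne_of_mem_erase hj)]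
  have hline : HasDerivAt (fun t : ℝ => (WithLp.toLp 2 (Function.update y i t) :
      EuclideanSpace ℝ (Fin d))) (EuclideanSpace.single i (1 : ℝ)) t := by
    have := (PiLp.hasStrictFDerivAt_toLp (𝕜 := ℝ) 2 (E := fun _ : Fin d => ℝ)
      (Function.update y i t)).hasFDerivAt.comp_hasDerivAt t (hasDerivAt_update y i t)
    exact this
  have hD : HasDerivAt (fun t : ℝ => pdMulti β f (WithLp.toLp 2 (Function.update y i t)))
      (pdMulti (Function.update β i (β i + 1)) f (WithLp.toLp 2 (Function.update y i t))) t := by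
    have h1 := ((pdMulti_smooth β hf).differentiable (by simp)
      (WithLp.toLp 2 (Function.update y i t))).hasFDerivAt.comp_hasDerivAt t hline
    rw [← pd_pdMulti i β hf]
    exact h1
  have hP : HasDerivAt (fun t : ℝ => (t : ℂ) ^ (α i)) (α i * (t : ℂ) ^ (α i - 1)) t := by
    exact (hasDerivAt_pow (α i) (t : ℂ)).comp_ofReal
  unfold GG
  simp only [hprod, hR, Function.update_self]
  refine ((hP.mul_const (∏ j ∈ Finset.univ.erase i, (y j : ℂ) ^ (α j))).mul hD).congr_deriv ?_
  ring

/-- Unit-interval measures based at `x`. -/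
noncomputable def cubeMeas {d : ℕ} (x : Fin d → ℝ) (i : Fin d) : Measure ℝ :=
  volume.restrict (Set.Icc (x i) (x i + 1))

instance {d : ℕ} (x : Fin d → ℝ) (i : Fin d) : IsProbabilityMeasure (cubeMeas x i) :=
  ⟨by simp [cubeMeas]⟩

/-- Partial integral of `|y^α ∂^β f|` over the coordinates in `S`. -/
noncomputable def NN {d : ℕ} (f : EuclideanSpace ℝ (Fin d) → ℂ) (x : Fin d → ℝ)
    (S : Finset (Fin d)) (α β : Fin d → ℕ) : ℝ≥0∞ :=
  lmarginal (cubeMeas x) S (fun y => ‖GG f α β y‖ₑ) x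

theorem NN_step {d : ℕ} {f : EuclideanSpace ℝ (Fin d) → ℂ} (hf : ContDiff ℝ (⊤ : ℕ∞) f)
    (x : Fin d → ℝ) (S : Finset (Fin d)) (i : Fin d) (hi : i ∉ S) (α β : Fin d → ℕ) :
    NN f x S α β ≤ NN f x (insert i S) α β
      + α i * NN f x (insert i S) (Function.update α i (α i - 1)) β
      + NN f x (insert i S) α (Function.update β i (β i + 1)) := by
  have hm : ∀ α β, Measurable fun y => ‖GG f α β y‖ₑ := fun α β =>
    (GG_cont hf α β).enorm.measurable
  have hm' : ∀ α β, Measurable fun y => ∫⁻ t, ‖GG f α β (Function.update y i t)‖ₑ ∂(cubeMeas x i) := by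
    intro α β
    refine Measurable.lintegral_prod_right (f := fun (y : Fin d → ℝ) (t : ℝ) =>
      ‖GG f α β (Function.update y i t)‖ₑ) ?_
    exact (hm α β).comp ((continuous_fst.update i continuous_snd).measurable)
  have hm2 : ∀ α β, Measurable fun z : (j : S) → ℝ =>
      ∫⁻ t, ‖GG f α β (Function.update (Function.updateFinset x S z) i t)‖ₑ ∂(cubeMeas x i) :=
    fun α β => (hm' α β).comp measurable_updateFinset
  unfold NN
  simp only [lmarginal_insert' _ (hm _ _) hi]
  unfold lmarginal
  rw [← lintegral_const_mul _ (hm2 _ _), ← lintegral_add_left (hm2 _ _),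
    ← lintegral_add_right _ (hm2 _ _)]
  refine lintegral_mono fun z => ?_
  set y := Function.updateFinset x S z with hy
  have hyi : y i = x i := by simp [hy, Function.updateFinset, hi]
  have hc : ∀ α β, Continuous fun t => GG f α β (Function.update y i t) := fun α β =>
    (GG_cont hf α β).comp (continuous_const.update i continuous_id)
  have h1 := oneD (GG_deriv hf α β i y) ((continuous_const.mul (hc _ _)).add (hc _ _)) (x i)
  have e : Function.update y i (x i) = y := by rw [← hyi, Function.update_eq_self]
  simp only [e] at h1
  refine h1.trans ?_
  have mm : ∀ α β, Measurable fun t => ‖GG f α β (Function.update y i t)‖ₑ :=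
    fun α β => (hc α β).enorm.measurable
  rw [← lintegral_const_mul _ (mm _ _), ← lintegral_add_left (mm _ _),
    ← lintegral_add_right _ (mm _ _)]
  refine lintegral_mono fun t => ?_
  simp only
  rw [add_assoc]
  gcongr
  refine (enorm_add_le _ _).trans ?_
  rw [enorm_mul]
  gcongr
  simp [enorm_eq_nnnorm]

theorem NN_univ {d : ℕ} {f : EuclideanSpace ℝ (Fin d) → ℂ} (hf : ContDiff ℝ (⊤ : ℕ∞) f)
    (x : Fin d → ℝ) (α β : Fin d → ℕ) :
    NN f x Finset.univ α β ≤
      eLpNorm (fun x : EuclideanSpace ℝ (Fin d) => (∏ j, (x j : ℂ) ^ (α j)) * pdMulti β f x)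
        2 volume := by
  unfold NN
  have hpi : Measure.pi (cubeMeas x) = (volume : Measure (Fin d → ℝ)).restrict
      (Set.univ.pi fun i => Set.Icc (x i) (x i + 1)) := by
    rw [volume_pi, Measure.restrict_pi_pi]; rfl
  rw [lmarginal_univ]
  simp only
  have hG := (GG_cont hf α β)
  rw [← eLpNorm_one_eq_lintegral_enorm]
  refine (eLpNorm_le_eLpNorm_of_exponent_le (q := 2) (by norm_num)
    hG.aestronglyMeasurable).trans ?_
  rw [hpi]
  refine (eLpNorm_mono_measure _ Measure.restrict_le_self).trans ?_
  have hc : Continuous (fun x : EuclideanSpace ℝ (Fin d) =>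
      (∏ j, (x j : ℂ) ^ (α j)) * pdMulti β f x) := by
    have h := (pdMulti_smooth β hf).continuous
    fun_prop
  rw [← eLpNorm_comp_measurePreserving hc.aestronglyMeasurable
    (PiLp.volume_preserving_toLp (Fin d))]
  exact le_rfl

/-- One-coordinate weight. -/
noncomputable def vv (s h : ℝ) (a b : ℕ) : ℝ := h ^ (a + b) * ((a ! : ℝ) * (b ! : ℝ)) ^ s

/-- One-coordinate enlarged weight. -/
noncomputable def VV (s h : ℝ) (a b : ℕ) : ℝ :=
  (2 + 1 / h) * ((2 : ℝ) ^ (1 + s)) ^ (a + b) * vv s h a b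

theorem prod_vv {d : ℕ} (s h : ℝ) (α β : Fin d → ℕ) :
    ∏ j, vv s h (α j) (β j) = h ^ (∑ j, α j + ∑ j, β j) *
        ((∏ j, ((α j)! : ℝ)) * ∏ j, ((β j)! : ℝ)) ^ s := by
  unfold vv
  rw [Finset.prod_mul_distrib, Finset.prod_pow_eq_pow_sum, Finset.sum_add_distrib,
    Real.finsetProd_rpow _ _ (fun _ _ => by positivity), Finset.prod_mul_distrib]

theorem prod_VV {d : ℕ} (s h : ℝ) (α β : Fin d → ℕ) :
    ∏ j, VV s h (α j) (β j) = (2 + 1 / h) ^ d *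
      ((2 : ℝ) ^ (1 + s) * h) ^ (∑ j, α j + ∑ j, β j) *
        ((∏ j, ((α j)! : ℝ)) * ∏ j, ((β j)! : ℝ)) ^ s := by
  unfold VV
  rw [Finset.prod_mul_distrib, prod_vv, Finset.prod_mul_distrib, Finset.prod_pow_eq_pow_sum,
    Finset.sum_add_distrib, mul_pow]
  simp
  ring

/-- Mixed weight: small in the coordinates of `S`, enlarged elsewhere. -/
noncomputable def WW {d : ℕ} (s h : ℝ) (S : Finset (Fin d)) (α β : Fin d → ℕ) : ℝ :=
  ∏ j, if j ∈ S then vv s h (α j) (β j) else VV s h (α j) (β j)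

theorem vv_nonneg (s h : ℝ) (h0 : 0 < h) (a b : ℕ) : 0 ≤ vv s h a b := by
  unfold vv; positivity

theorem VV_nonneg (s h : ℝ) (h0 : 0 < h) (a b : ℕ) : 0 ≤ VV s h a b := by
  unfold VV vv; positivity

theorem WW_nonneg {d : ℕ} (s h : ℝ) (h0 : 0 < h) (S : Finset (Fin d)) (α β : Fin d → ℕ) :
    0 ≤ WW s h S α β := by
  refine Finset.prod_nonneg fun j _ => ?_
  split_ifs
  · exact vv_nonneg s h h0 _ _
  · exact VV_nonneg s h h0 _ _

theorem WW_step {d : ℕ} (s h : ℝ) (hs : 0 ≤ s) (h0 : 0 < h) (h1 : h ≤ 1)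
    (S : Finset (Fin d)) (i : Fin d) (hi : i ∉ S) (α β : Fin d → ℕ) :
    WW s h (insert i S) α β
      + α i * WW s h (insert i S) (Function.update α i (α i - 1)) β
      + WW s h (insert i S) α (Function.update β i (β i + 1)) ≤ WW s h S α β := by
  set R : ℝ := ∏ j ∈ Finset.univ.erase i,
    if j ∈ S then vv s h (α j) (β j) else VV s h (α j) (β j) with hR
  have hR0 : 0 ≤ R := by
    refine Finset.prod_nonneg fun j _ => ?_
    split_ifs
    · exact vv_nonneg s h h0 _ _
    · exact VV_nonneg s h h0 _ _
  have key : ∀ α' β' : Fin d → ℕ, (∀ j, j ≠ i → α' j = α j) → (∀ j, j ≠ i → β' j = β j) →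
      WW s h (insert i S) α' β' = vv s h (α' i) (β' i) * R := by
    intro α' β' ha hb
    unfold WW
    rw [← Finset.mul_prod_erase _ _ (Finset.mem_univ i), if_pos (Finset.mem_insert_self _ _)]
    congr 1
    refine Finset.prod_congr rfl fun j hj => ?_
    have hj := Finset.ne_of_mem_erase hj
    simp [hj, ha j hj, hb j hj]
  have key2 : WW s h S α β = VV s h (α i) (β i) * R := by
    unfold WW
    rw [← Finset.mul_prod_erase _ _ (Finset.mem_univ i), if_neg hi]
  rw [key α β (fun _ _ => rfl) (fun _ _ => rfl),
    key _ β (fun j hj => Function.update_of_ne hj _ _) (fun _ _ => rfl),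
    key α _ (fun _ _ => rfl) (fun j hj => Function.update_of_ne hj _ _), key2,
    Function.update_self, Function.update_self]
  have := mul_le_mul_of_nonneg_right (scalar_step s h hs h0 h1 (α i) (β i)) hR0
  unfold VV vv
  calc _ = _ := by ring
    _ ≤ _ := this

theorem NN_bound {d : ℕ} {f : EuclideanSpace ℝ (Fin d) → ℂ} (hf : ContDiff ℝ (⊤ : ℕ∞) f)
    (s h : ℝ) (hs : 0 ≤ s) (h0 : 0 < h) (h1 : h ≤ 1)
    (x : Fin d → ℝ) (T : Finset (Fin d)) : ∀ (α β : Fin d → ℕ),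
    NN f x Tᶜ α β ≤ ENNReal.ofReal (WW s h Tᶜ α β) * gsL2Seminorm s h f := by
  induction T using Finset.induction_on with
  | empty =>
    intro α β
    rw [Finset.compl_empty]
    refine (NN_univ hf x α β).trans ?_
    have hw : WW s h Finset.univ α β = h ^ (∑ j, α j + ∑ j, β j) *
        ((∏ j, ((α j)! : ℝ)) * ∏ j, ((β j)! : ℝ)) ^ s := by
      rw [← prod_vv]; simp [WW]
    have hpos : 0 < h ^ (∑ j, α j + ∑ j, β j) *
        ((∏ j, ((α j)! : ℝ)) * ∏ j, ((β j)! : ℝ)) ^ s := by positivity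
    rw [hw, mul_comm, ← ENNReal.div_le_iff (by simpa using hpos) ENNReal.ofReal_ne_top]
    unfold gsL2Seminorm
    exact le_iSup₂ (f := fun (γ : Fin d → ℕ) (κ : Fin d → ℕ) =>
      eLpNorm (fun x : EuclideanSpace ℝ (Fin d) => (∏ j, (x j : ℂ) ^ (γ j)) * pdMulti κ f x)
        2 volume / ENNReal.ofReal (h ^ (∑ j, γ j + ∑ j, κ j) *
        ((∏ j, ((γ j)! : ℝ)) * ∏ j, ((κ j)! : ℝ)) ^ s)) α β
  | insert i T hi ih =>
    intro α β
    have hS : Tᶜ = insert i (insert i T)ᶜ := by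
      ext j; by_cases hj : j = i <;> simp [hj, hi]
    have hiS : i ∉ (insert i T)ᶜ := by simp
    rw [hS] at ih
    refine (NN_step hf x _ i hiS α β).trans ?_
    have hW := WW_nonneg s h h0 (insert i (insert i T)ᶜ)
    calc _ ≤ ENNReal.ofReal (WW s h (insert i (insert i T)ᶜ) α β) * gsL2Seminorm s h f
          + α i * (ENNReal.ofReal (WW s h (insert i (insert i T)ᶜ)
              (Function.update α i (α i - 1)) β) * gsL2Seminorm s h f)
          + ENNReal.ofReal (WW s h (insert i (insert i T)ᶜ) α
              (Function.update β i (β i + 1))) * gsL2Seminorm s h f := by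
          gcongr <;> apply ih
      _ = ENNReal.ofReal (WW s h (insert i (insert i T)ᶜ) α β
          + α i * WW s h (insert i (insert i T)ᶜ) (Function.update α i (α i - 1)) β
          + WW s h (insert i (insert i T)ᶜ) α (Function.update β i (β i + 1)))
            * gsL2Seminorm s h f := by
          rw [ENNReal.ofReal_add (add_nonneg (hW _ _) (mul_nonneg (by positivity) (hW _ _)))
            (hW _ _), ENNReal.ofReal_add (hW _ _) (mul_nonneg (by positivity) (hW _ _)),
            ENNReal.ofReal_mul (by positivity), ENNReal.ofReal_natCast]
          ring
      _ ≤ _ := by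
          gcongr
          exact WW_step s h hs h0 h1 _ i hiS α β

/-- Let `d ≥ 1`, `s > 1/2`.  For every `0 < h ≤ 1` there is `C > 0` such that
for every smooth `f : ℝ^d → ℂ`, all multi-indices `α, β` and all `x`:
`|x^α ∂^β f(x)| ≤ C (2^{1+s} h)^{|α+β|} (α!β!)^s ‖f‖_h`
(the inequality is trivially true when `‖f‖_h = ∞`). -/
theorem pointwise_bound_by_gsL2Seminorm (d : ℕ) (hd : 1 ≤ d) (s : ℝ) (hs : 1 / 2 < s) :
    ∀ h : ℝ, 0 < h → h ≤ 1 → ∃ C : ℝ, 0 < C ∧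
      ∀ f : EuclideanSpace ℝ (Fin d) → ℂ, ContDiff ℝ (⊤ : ℕ∞) f →
        ∀ (α β : Fin d → ℕ) (x : EuclideanSpace ℝ (Fin d)),
          ENNReal.ofReal ‖(∏ j, (x j : ℂ) ^ (α j)) * pdMulti β f x‖ ≤
            ENNReal.ofReal (C * ((2 : ℝ) ^ (1 + s) * h) ^ (∑ j, α j + ∑ j, β j) *
                ((∏ j, ((α j)! : ℝ)) * ∏ j, ((β j)! : ℝ)) ^ s) *
              gsL2Seminorm s h f := by
  intro h h0 h1
  refine ⟨(2 + 1 / h) ^ d, by positivity, fun f hf α β x => ?_⟩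
  have hb := NN_bound hf s h (by linarith) h0 h1 (WithLp.ofLp x) Finset.univ α β
  rw [Finset.compl_univ] at hb
  have hW : WW s h (∅ : Finset (Fin d)) α β = ∏ j, VV s h (α j) (β j) := by simp [WW]
  rw [hW, prod_VV] at hb
  rw [ofReal_norm]
  refine le_trans (le_of_eq ?_) hb
  unfold NN
  rw [lmarginal_empty]
  rfl
end

section
/- Let B be a bounded subset of the Schwartz space 𝒮(ℝ^d) (i.e., every Schwartz seminorm is uniformly bounded on B). Then for every ε > 0 there exist finitely many functions φ_1, …, φ_K ∈ 𝒮(ℝ^d) such that B ⊆ ⋃_{j=1}^K { φ ∈ 𝒮(ℝ^d) : ‖φ − φ_j‖_{L²(ℝ^d)} < ε }; that is, B is totally bounded with respect to the L² norm. -/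
open scoped Nat
open MeasureTheory

/-- The Schwartz seminorm `‖ψ‖_n = max_{|α+β| ≤ n} sup_x |x^α ∂^β ψ(x)|`
(expressed as a supremum over the pairs of multi-indices with `|α| + |β| ≤ n`). -/
noncomputable def schwartzSeminorm {d : ℕ} (n : ℕ) (ψ : EuclideanSpace ℝ (Fin d) → ℂ) : ℝ :=
  ⨆ (p : {q : (Fin d → ℕ) × (Fin d → ℕ) // (∑ j, q.1 j) + (∑ j, q.2 j) ≤ n})
    (x : EuclideanSpace ℝ (Fin d)),
      ‖(∏ j, (x j : ℂ) ^ (p.val.1 j)) * pdMulti p.val.2 ψ x‖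

open scoped LineDeriv in
lemma pd_schwartz {d : ℕ} (j : Fin d) (f : SchwartzMap (EuclideanSpace ℝ (Fin d)) ℂ) :
    ∃ g : SchwartzMap (EuclideanSpace ℝ (Fin d)) ℂ, pd j (⇑f) = ⇑g :=
  ⟨∂_{EuclideanSpace.single j (1 : ℝ)} f, by
    ext x; rw [SchwartzMap.lineDerivOp_apply_eq_fderiv]; rfl⟩

lemma pd_iter_schwartz {d : ℕ} (j : Fin d) (k : ℕ)
    (f : SchwartzMap (EuclideanSpace ℝ (Fin d)) ℂ) :
    ∃ g : SchwartzMap (EuclideanSpace ℝ (Fin d)) ℂ, (pd j)^[k] (⇑f) = ⇑g := by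
  induction k with
  | zero => exact ⟨f, rfl⟩
  | succ k ih =>
    obtain ⟨g, hg⟩ := ih
    obtain ⟨h, hh⟩ := pd_schwartz j g
    exact ⟨h, by rw [Function.iterate_succ_apply', hg, hh]⟩

lemma pdMulti_schwartz {d : ℕ} (α : Fin d → ℕ)
    (f : SchwartzMap (EuclideanSpace ℝ (Fin d)) ℂ) :
    ∃ g : SchwartzMap (EuclideanSpace ℝ (Fin d)) ℂ, pdMulti α (⇑f) = ⇑g := by
  unfold pdMulti
  induction List.finRange d with
  | nil => exact ⟨f, rfl⟩
  | cons j l ih =>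
    obtain ⟨g, hg⟩ := ih
    obtain ⟨h, hh⟩ := pd_iter_schwartz j (α j) g
    exact ⟨h, by rw [List.foldr_cons, hg, hh]⟩

lemma pdMulti_zero {d : ℕ} (f : EuclideanSpace ℝ (Fin d) → ℂ) :
    pdMulti (0 : Fin d → ℕ) f = f := by
  unfold pdMulti
  induction List.finRange d with
  | nil => rfl
  | cons j l ih => rw [List.foldr_cons, ih]; rfl

lemma pdMulti_single {d : ℕ} (j : Fin d) (f : EuclideanSpace ℝ (Fin d) → ℂ) :
    pdMulti (Pi.single j 1 : Fin d → ℕ) f = pd j f := by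
  unfold pdMulti
  have key : ∀ l : List (Fin d), l.Nodup →
      l.foldr (fun i g => (pd i)^[(Pi.single j 1 : Fin d → ℕ) i] g) f =
        if j ∈ l then pd j f else f := by
    intro l hl
    induction l with
    | nil => simp
    | cons i l ih =>
      rw [List.nodup_cons] at hl
      rw [List.foldr_cons, ih hl.2]
      by_cases hij : i = j
      · subst hij
        simp [hl.1]
      · simp [Pi.single_eq_of_ne hij, Ne.symm hij]
  rw [key _ (List.nodup_finRange d)]
  simp

lemma bdd_monomial {d : ℕ} (α β : Fin d → ℕ)
    (f : SchwartzMap (EuclideanSpace ℝ (Fin d)) ℂ) :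
    BddAbove (Set.range fun x : EuclideanSpace ℝ (Fin d) =>
      ‖(∏ j, (x j : ℂ) ^ (α j)) * pdMulti β (⇑f) x‖) := by
  obtain ⟨g, hg⟩ := pdMulti_schwartz β f
  rw [hg]
  refine ⟨SchwartzMap.seminorm ℝ (∑ j, α j) 0 g, ?_⟩
  rintro _ ⟨x, rfl⟩
  refine le_trans ?_ (SchwartzMap.norm_pow_mul_le_seminorm ℝ g (∑ j, α j) x)
  simp only [norm_mul]
  gcongr
  rw [norm_prod, ← Finset.prod_pow_eq_pow_sum]
  refine Finset.prod_le_prod (fun _ _ => norm_nonneg _) fun j _ => ?_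
  rw [norm_pow, Complex.norm_real]
  gcongr
  exact PiLp.norm_apply_le x j

lemma le_schwartzSeminorm {d : ℕ} (n : ℕ) (α β : Fin d → ℕ)
    (h : (∑ j, α j) + (∑ j, β j) ≤ n)
    (f : SchwartzMap (EuclideanSpace ℝ (Fin d)) ℂ) (x : EuclideanSpace ℝ (Fin d)) :
    ‖(∏ j, (x j : ℂ) ^ (α j)) * pdMulti β (⇑f) x‖ ≤ schwartzSeminorm n (⇑f) := by
  have hfin : Finite {q : (Fin d → ℕ) × (Fin d → ℕ) // (∑ j, q.1 j) + (∑ j, q.2 j) ≤ n} := by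
    refine Set.Finite.to_subtype
      (((Set.finite_Icc (0 : Fin d → ℕ) (fun _ => n)).prod
        (Set.finite_Icc (0 : Fin d → ℕ) (fun _ => n))).subset ?_)
    intro q hq
    have hq' : (∑ j, q.1 j) + (∑ j, q.2 j) ≤ n := hq
    refine ⟨⟨fun _ => Nat.zero_le _, fun j => ?_⟩, ⟨fun _ => Nat.zero_le _, fun j => ?_⟩⟩
    · have := Finset.single_le_sum (fun i _ => Nat.zero_le (q.1 i)) (Finset.mem_univ j)
      show q.1 j ≤ n
      omega
    · have := Finset.single_le_sum (fun i _ => Nat.zero_le (q.2 i)) (Finset.mem_univ j)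
      show q.2 j ≤ n
      omega
  unfold schwartzSeminorm
  refine le_trans (le_ciSup (bdd_monomial α β f) x) ?_
  exact le_ciSup (f := fun p : {q : (Fin d → ℕ) × (Fin d → ℕ) //
      (∑ j, q.1 j) + (∑ j, q.2 j) ≤ n} => ⨆ x : EuclideanSpace ℝ (Fin d),
      ‖(∏ j, (x j : ℂ) ^ (p.val.1 j)) * pdMulti p.val.2 (⇑f) x‖)
    (Set.finite_range _).bddAbove ⟨(α, β), h⟩

lemma coord_bound {d : ℕ} (k : ℕ) (j : Fin d)
    (f : SchwartzMap (EuclideanSpace ℝ (Fin d)) ℂ) (x : EuclideanSpace ℝ (Fin d)) :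
    |x j| ^ k * ‖f x‖ ≤ schwartzSeminorm k (⇑f) := by
  have := le_schwartzSeminorm k (Pi.single j k) 0 (by simp) f x
  rw [pdMulti_zero, norm_mul, norm_prod, Finset.prod_eq_single j] at this
  · simpa using this
  · intro i _ hi
    simp [Pi.single_eq_of_ne hi]
  · simp

lemma zero_bound {d : ℕ}
    (f : SchwartzMap (EuclideanSpace ℝ (Fin d)) ℂ) (x : EuclideanSpace ℝ (Fin d)) :
    ‖f x‖ ≤ schwartzSeminorm 0 (⇑f) := by
  have := le_schwartzSeminorm 0 0 0 (by simp) f x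
  rw [pdMulti_zero] at this
  simpa using this

lemma deriv_bound {d : ℕ} (j : Fin d)
    (f : SchwartzMap (EuclideanSpace ℝ (Fin d)) ℂ) (x : EuclideanSpace ℝ (Fin d)) :
    ‖fderiv ℝ f x (EuclideanSpace.single j 1)‖ ≤ schwartzSeminorm 1 (⇑f) := by
  have := le_schwartzSeminorm 1 0 (Pi.single j 1) (by simp) f x
  rw [pdMulti_single] at this
  simpa [pd] using this

lemma euclid_eq_sum {d : ℕ} (v : EuclideanSpace ℝ (Fin d)) :
    v = ∑ j, v j • EuclideanSpace.single j (1 : ℝ) := by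
  ext i
  simp [Pi.single_apply]

lemma fderiv_bound {d : ℕ}
    (f : SchwartzMap (EuclideanSpace ℝ (Fin d)) ℂ) (x : EuclideanSpace ℝ (Fin d)) :
    ‖fderiv ℝ f x‖ ≤ d * schwartzSeminorm 1 (⇑f) := by
  have h0 : (0 : ℝ) ≤ d * schwartzSeminorm 1 (⇑f) := by
    rcases Nat.eq_zero_or_pos d with h | h
    · simp [h]
    · have := (norm_nonneg _).trans (deriv_bound ⟨0, h⟩ f x)
      positivity
  refine ContinuousLinearMap.opNorm_le_bound _ h0 fun v => ?_
  conv_lhs => rw [euclid_eq_sum v, map_sum]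
  refine (norm_sum_le _ _).trans ?_
  have : ∀ j ∈ (Finset.univ : Finset (Fin d)),
      ‖fderiv ℝ f x (v j • EuclideanSpace.single j (1 : ℝ))‖ ≤
        ‖v‖ * schwartzSeminorm 1 (⇑f) := by
    intro j _
    rw [map_smul, norm_smul]
    exact mul_le_mul (PiLp.norm_apply_le v j) (deriv_bound j f x) (norm_nonneg _) (norm_nonneg _)
  refine (Finset.sum_le_sum this).trans (le_of_eq ?_)
  simp
  ring

lemma lip_bound {d : ℕ}
    (f : SchwartzMap (EuclideanSpace ℝ (Fin d)) ℂ) (x y : EuclideanSpace ℝ (Fin d)) :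
    ‖f x - f y‖ ≤ d * schwartzSeminorm 1 (⇑f) * ‖x - y‖ :=
  convex_univ.norm_image_sub_le_of_norm_fderiv_le (𝕜 := ℝ) (fun z _ => f.differentiableAt)
    (fun z _ => fderiv_bound f z) (Set.mem_univ _) (Set.mem_univ _)

lemma norm_le_sum_abs {d : ℕ} (v : EuclideanSpace ℝ (Fin d)) : ‖v‖ ≤ ∑ j, |v j| := by
  conv_lhs => rw [euclid_eq_sum v]
  refine (norm_sum_le _ _).trans (le_of_eq ?_)
  simp [norm_smul]

lemma pow_bound {d : ℕ} (k : ℕ)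
    (f : SchwartzMap (EuclideanSpace ℝ (Fin d)) ℂ) (x : EuclideanSpace ℝ (Fin d)) :
    ‖x‖ ^ (k + 1) * ‖f x‖ ≤ (d : ℝ) ^ (k + 1) * schwartzSeminorm (k + 1) (⇑f) := by
  rcases Nat.eq_zero_or_pos d with h | h
  · subst h
    have : x = 0 := Subsingleton.elim _ _
    simp [this]
  have h1 := pow_sum_div_card_le_sum_pow (s := (Finset.univ : Finset (Fin d)))
    (f := fun j => |x j|) (fun j _ => abs_nonneg _) k
  have hd : (0 : ℝ) < d := by exact_mod_cast h
  rw [Finset.card_univ, Fintype.card_fin, div_le_iff₀ (by positivity)] at h1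
  have h2 : ‖x‖ ^ (k + 1) ≤ (∑ j, |x j|) ^ (k + 1) := by
    gcongr
    exact norm_le_sum_abs x
  calc ‖x‖ ^ (k + 1) * ‖f x‖ ≤ ((∑ j, |x j| ^ (k + 1)) * (d : ℝ) ^ k) * ‖f x‖ := by
        gcongr
        exact h2.trans h1
    _ = (d : ℝ) ^ k * ∑ j, |x j| ^ (k + 1) * ‖f x‖ := by
        rw [← Finset.sum_mul]; ring
    _ ≤ (d : ℝ) ^ k * ∑ _j : Fin d, schwartzSeminorm (k + 1) (⇑f) := by
        gcongr with j
        exact coord_bound (k + 1) j f x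
    _ = _ := by simp; ring

lemma weight_bound {d : ℕ} (k : ℕ)
    (f : SchwartzMap (EuclideanSpace ℝ (Fin d)) ℂ) (x : EuclideanSpace ℝ (Fin d)) :
    (1 + ‖x‖) ^ (k + 1) * ‖f x‖ ≤
      2 ^ k * (schwartzSeminorm 0 (⇑f) + (d : ℝ) ^ (k + 1) * schwartzSeminorm (k + 1) (⇑f)) := by
  have h := add_pow_le (zero_le_one (α := ℝ)) (norm_nonneg x) (k + 1)
  simp only [one_pow, Nat.add_sub_cancel] at h
  calc (1 + ‖x‖) ^ (k + 1) * ‖f x‖ ≤ (2 ^ k * (1 + ‖x‖ ^ (k + 1))) * ‖f x‖ := by gcongr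
    _ = 2 ^ k * (‖f x‖ + ‖x‖ ^ (k + 1) * ‖f x‖) := by ring
    _ ≤ _ := by
      exact mul_le_mul_of_nonneg_left (add_le_add (zero_bound f x) (pow_bound k f x))
        (by positivity)

lemma weighted_eLpNorm {d : ℕ} : ∃ (k : ℕ) (W : ℝ), 0 < W ∧
    ∀ (f : EuclideanSpace ℝ (Fin d) → ℂ) (M : ℝ), Continuous f →
      (∀ x, (1 + ‖x‖) ^ k * ‖f x‖ ≤ M) → eLpNorm f 2 volume ≤ ENNReal.ofReal (W * M) := by
  obtain ⟨k, hk⟩ := Measure.HasTemperateGrowth.exists_eLpNorm_lt_top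
    (μ := (volume : Measure (EuclideanSpace ℝ (Fin d)))) 2 inferInstance
  set w := eLpNorm (fun x : EuclideanSpace ℝ (Fin d) ↦ (1 + ‖x‖) ^ (-k : ℝ)) 2 volume with hw
  refine ⟨k, w.toReal + 1, by positivity, fun f M hf hM => ?_⟩
  have hM0 : 0 ≤ M := le_trans (by positivity) (hM 0)
  have h_one_add (x : EuclideanSpace ℝ (Fin d)) : 0 < 1 + ‖x‖ := by positivity
  calc eLpNorm f 2 volume
    _ = eLpNorm ((fun x : EuclideanSpace ℝ (Fin d) ↦ (1 + ‖x‖) ^ (-k : ℝ)) •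
          fun x ↦ (1 + ‖x‖) ^ k • f x) 2 volume := by
      refine congrArg (eLpNorm · 2 volume) (funext fun x ↦ ?_)
      have hne : (1 + ‖x‖) ^ k ≠ 0 := pow_ne_zero _ (h_one_add x).ne'
      rw [Pi.smul_apply', Real.rpow_neg (h_one_add x).le, Real.rpow_natCast, smul_smul,
        inv_mul_cancel₀ hne, one_smul]
    _ ≤ w * eLpNorm (fun x ↦ (1 + ‖x‖) ^ k • f x) ⊤ volume := by
      refine eLpNorm_smul_le_eLpNorm_mul_eLpNorm_top 2 _ ?_
      refine Continuous.aestronglyMeasurable ?_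
      exact .rpow_const (by fun_prop) fun x ↦ .inl (h_one_add x).ne'
    _ ≤ w * ENNReal.ofReal M := by
      gcongr
      refine eLpNormEssSup_le_of_ae_bound (ae_of_all _ fun x ↦ ?_)
      rw [norm_smul, Real.norm_of_nonneg (by positivity)]
      exact hM x
    _ ≤ _ := by
      rw [ENNReal.ofReal_mul (by positivity)]
      gcongr
      refine (ENNReal.ofReal_toReal hk.ne).symm.le.trans ?_
      exact ENNReal.ofReal_le_ofReal (by simp)

/-- Let `B` be a bounded subset of the Schwartz space `𝒮(ℝ^d)` (every
Schwartz seminorm is uniformly bounded on `B`).  Then for every `ε > 0` there are finitely many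
Schwartz functions `g_1, …, g_K` such that every `f ∈ B` is within L²-distance `ε` of some
`g_j`; that is, `B` is totally bounded with respect to the `L²` norm. -/
theorem schwartz_bounded_totallyBounded_L2 (d : ℕ)
    (B : Set (SchwartzMap (EuclideanSpace ℝ (Fin d)) ℂ))
    (hB : ∀ n : ℕ, ∃ C : ℝ, ∀ f ∈ B, schwartzSeminorm n (⇑f) ≤ C) :
    ∀ ε : ℝ, 0 < ε → ∃ (K : ℕ) (g : Fin K → SchwartzMap (EuclideanSpace ℝ (Fin d)) ℂ),
      ∀ f ∈ B, ∃ j : Fin K,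
        eLpNorm (fun x => f x - g j x) 2 volume < ENNReal.ofReal ε := by
  intro ε hε
  obtain ⟨k, W, hW, hWk⟩ := weighted_eLpNorm (d := d)
  obtain ⟨C0, hC0⟩ := hB 0
  obtain ⟨C1, hC1⟩ := hB 1
  obtain ⟨C2, hC2⟩ := hB (k + 1)
  obtain ⟨C, hCpos, hC⟩ : ∃ C : ℝ, 0 < C ∧ ∀ f ∈ B, ∀ x, (1 + ‖x‖) ^ (k + 1) * ‖f x‖ ≤ C := by
    refine ⟨max 1 (2 ^ k * (C0 + (d : ℝ) ^ (k + 1) * C2)), by positivity, fun f hf x => ?_⟩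
    refine (weight_bound k f x).trans (le_trans ?_ (le_max_right _ _))
    gcongr
    · exact hC0 f hf
    · exact hC2 f hf
  obtain ⟨L, hLpos, hL⟩ : ∃ L : ℝ, 0 < L ∧ ∀ f ∈ B, ∀ x y, ‖f x - f y‖ ≤ L * ‖x - y‖ := by
    refine ⟨max 1 (d * C1), by positivity, fun f hf x y => (lip_bound f x y).trans ?_⟩
    gcongr
    refine le_trans ?_ (le_max_right _ _)
    gcongr
    exact hC1 f hf
  -- target sup bound
  set M : ℝ := ε / (2 * W) with hMdef
  have hM : 0 < M := by positivity
  set R : ℝ := 2 * C / M with hR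
  have hRpos : 0 < R := by positivity
  set η : ℝ := M / (1 + R) ^ k / 3 with hη
  have hηpos : 0 < η := by positivity
  obtain ⟨t, -, htfin, htcov⟩ := finite_cover_balls_of_compact
    (isCompact_closedBall (0 : EuclideanSpace ℝ (Fin d)) R) (e := η / L) (by positivity)
  have := htfin.fintype
  let ev : SchwartzMap (EuclideanSpace ℝ (Fin d)) ℂ → (t → ℂ) := fun f i => f i
  have htb : TotallyBounded (ev '' B) := by
    refine TotallyBounded.subset ?_ (isCompact_closedBall (0 : t → ℂ) C).totallyBounded
    rintro _ ⟨f, hf, rfl⟩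
    rw [mem_closedBall_zero_iff, pi_norm_le_iff_of_nonneg hCpos.le]
    intro i
    refine le_trans ?_ (hC f hf i)
    exact le_mul_of_one_le_left (norm_nonneg _) (one_le_pow₀ (by simp))
  obtain ⟨s, hsB, hsfin, hscov⟩ := htb.exists_subset (Metric.dist_mem_uniformity hηpos)
  have := hsfin.fintype
  choose G hGB hG using hsB
  let e := Fintype.equivFin s
  refine ⟨Fintype.card s, fun j => G (e.symm j).2, fun f hf => ?_⟩
  have hmem := hscov (Set.mem_image_of_mem ev hf)
  simp only [Set.mem_iUnion, Set.mem_ofPred_eq] at hmem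
  obtain ⟨y, hy, hfy⟩ := hmem
  refine ⟨e ⟨y, hy⟩, ?_⟩
  simp only [Equiv.symm_apply_apply]
  set g := G hy with hg
  have hgB : g ∈ B := hGB hy
  have hgy : ev g = y := hG hy
  rw [← hgy] at hfy
  have hsup : ∀ x, (1 + ‖x‖) ^ k * ‖f x - g x‖ ≤ M := by
    intro x
    rcases le_total ‖x‖ R with hx | hx
    · have hx' := htcov (mem_closedBall_zero_iff.2 hx)
      simp only [Set.mem_iUnion, Metric.mem_ball, dist_eq_norm] at hx'
      obtain ⟨z, hz, hxz⟩ := hx'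
      have h1 : ‖f z - g z‖ < η := by
        have := (dist_le_pi_dist (ev f) (ev g) ⟨z, hz⟩).trans_lt hfy
        rwa [dist_eq_norm] at this
      have hLz : L * ‖x - z‖ ≤ η := by
        rw [lt_div_iff₀ hLpos] at hxz
        linarith
      have h2 := (hL f hf x z).trans hLz
      have h3 := (hL g hgB x z).trans hLz
      have h4 : ‖f x - g x‖ ≤ 3 * η := by
        have h5 : f x - g x = (f x - f z) + (f z - g z) - (g x - g z) := by ring
        rw [h5]
        have h6 := norm_sub_le ((f x - f z) + (f z - g z)) (g x - g z)
        have h7 := norm_add_le (f x - f z) (f z - g z)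
        linarith
      calc (1 + ‖x‖) ^ k * ‖f x - g x‖ ≤ (1 + R) ^ k * (3 * η) := by gcongr
        _ = M := by
          rw [hη]
          field_simp
    · have h1 := hC f hf x
      have h2 := hC g hgB x
      have h3 : (1 + ‖x‖) ^ (k + 1) * ‖f x - g x‖ ≤ 2 * C := by
        have := mul_le_mul_of_nonneg_left (norm_sub_le (f x) (g x))
          (by positivity : 0 ≤ (1 + ‖x‖) ^ (k + 1))
        linarith
      have h4 : 2 * C = R * M := by
        rw [hR]
        field_simp
      have h5 : R * ((1 + ‖x‖) ^ k * ‖f x - g x‖) ≤ R * M := by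
        rw [← h4]
        refine le_trans ?_ h3
        rw [pow_succ', mul_assoc]
        gcongr
        linarith
      exact le_of_mul_le_mul_left h5 hRpos
  refine (hWk (fun x => f x - g x) M (f.continuous.sub g.continuous) hsup).trans_lt ?_
  rw [ENNReal.ofReal_lt_ofReal_iff hε]
  have : W * M = ε / 2 := by
    rw [hMdef]
    field_simp
  linarith
end
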